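/- The function Ω from LM_h(I \ {0}) to NS(Syz(F)) given by Ω(m) = min_{≤_sign} {s(f) : f ∈ I \ {0} with LM_h(f) = m} is well defined and bijective. -/

import Mathlib

open MvPolynomial

noncomputable section

namespace TropF5

/-- Variable index type: `none` is the homogenizing variable `h`,
`some (.inl i)` is `x i`, `some (.inr i)` is `∂ i` (resp. `ξ i`). -/
abbrev Vars (n : ℕ) := Option (Fin n ⊕ Fin n)

/-- The commutative polynomial ring `K[h, x, ξ]`. -/
abbrev Poly (n : ℕ) (K : Type*) [Field K] := MvPolynomial (Vars n) K

/-- Monomials (exponent vectors) of `K[h,x,ξ]`. -/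
abbrev Mon (n : ℕ) := Vars n →₀ ℕ

/-- Module monomials `h^γ x^α ξ^β e_i` of `K[h,x,ξ]^N`. -/
abbrev MMon (n N : ℕ) := Mon n × Fin N

/-- Total degree of a monomial. -/
def mdeg {n : ℕ} (d : Mon n) : ℕ := d.sum fun _ k => k

/-- The weight `w·(α,β)` of the `(x,ξ)`-part of a monomial. -/
def wdeg {n : ℕ} (w : Fin n ⊕ Fin n → ℝ) (d : Mon n) : ℝ :=
  ∑ j : Fin n ⊕ Fin n, w j * (d (some j) : ℝ)

/-- The `(x,ξ)`-part `x^α ξ^β` of a monomial `h^γ x^α ξ^β`. -/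
def xiPart {n : ℕ} (d : Mon n) : (Fin n ⊕ Fin n) →₀ ℕ :=
  Finsupp.equivFunOnFinite.symm fun j => d (some j)

/-- The data defining a tropical term order on `K[h,x,ξ]`: a valuation on `K`,
weight vectors `w, ω ∈ ℝ^{2n}`, and a monomial order `prec` used as tie-breaker. -/
structure OrdData (n : ℕ) (K : Type*) [Field K] where
  val : K → ℝ
  val_mul : ∀ a b : K, a ≠ 0 → b ≠ 0 → val (a * b) = val a + val b
  val_add : ∀ a b : K, a ≠ 0 → b ≠ 0 → a + b ≠ 0 → min (val a) (val b) ≤ val (a + b)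
  w : Fin n ⊕ Fin n → ℝ
  om : Fin n ⊕ Fin n → ℝ
  w_nonneg : ∀ i : Fin n, 0 ≤ w (Sum.inl i)
  w_big : ∀ i j : Fin n, w (Sum.inl j) < w (Sum.inr i)
  prec : LinearOrder ((Fin n ⊕ Fin n) →₀ ℕ)
  prec_add : ∀ u v t : (Fin n ⊕ Fin n) →₀ ℕ, prec.lt u v → prec.lt (u + t) (v + t)
  prec_zero_le : ∀ u, prec.le 0 u

variable {n N : ℕ} {K : Type*} [Field K]

/-- The strict tropical term order `<_h` on terms `a·d`, `b·e` of `K[h,x,ξ]`: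
first by total degree, then by `w`-weight, then by valuation-adjusted `ω`-weight,
and finally by the tie-breaking monomial order on the `(x,ξ)`-parts. -/
def ltTerm (D : OrdData n K) (a : K) (d : Mon n) (b : K) (e : Mon n) : Prop :=
  mdeg d < mdeg e ∨ (mdeg d = mdeg e ∧
    (wdeg D.w d < wdeg D.w e ∨ (wdeg D.w d = wdeg D.w e ∧
      (-D.val a + wdeg D.om d < -D.val b + wdeg D.om e ∨
        (-D.val a + wdeg D.om d = -D.val b + wdeg D.om e ∧
          D.prec.lt (xiPart d) (xiPart e))))))

/-- `d` is the `≤_h`-leading monomial of the polynomial `p`. -/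
def IsLM (D : OrdData n K) (p : Poly n K) (d : Mon n) : Prop :=
  d ∈ p.support ∧ ∀ e ∈ p.support, e ≠ d → ltTerm D (p.coeff e) e (p.coeff d) d

open Classical in
/-- The `≤_h`-leading monomial of a polynomial (junk value `0` if there is none). -/
def LM (D : OrdData n K) (p : Poly n K) : Mon n :=
  if h : ∃ d, IsLM D p d then h.choose else 0

/-- The module element `σ e_i` of `K[h,x,ξ]^N` corresponding to a module monomial. -/
def msingle {N : ℕ} (m : MMon n N) : Fin N → Poly n K := Pi.single m.2 (monomial m.1 1)

/-- Product of a monomial with a module monomial. -/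
def mulM {N : ℕ} (d : Mon n) (m : MMon n N) : MMon n N := (d + m.1, m.2)

/-- An abstract setting for the homogenized Weyl algebra `R = D_n^{(h)}(K)`:
a `K`-algebra `R` with generators `h, x_i, ∂_i` satisfying the Weyl relations,
the total-symbol `K`-linear isomorphism `Ψ_h : R ≃ K[h,x,ξ]` sending normally
ordered monomials to monomials, a tropical order datum, and a generating family
`F` of homogeneous elements. -/
structure Setting (n N : ℕ) (K : Type*) [Field K] (R : Type*) [Ring R] [Algebra K R] where
  D : OrdData n K
  /-- the generators: `Xg none = h`, `Xg (some (.inl i)) = x i`, `Xg (some (.inr i)) = ∂ i` -/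
  Xg : Vars n → R
  h_comm : ∀ v, Xg none * Xg v = Xg v * Xg none
  x_comm : ∀ i j : Fin n,
    Xg (some (Sum.inl i)) * Xg (some (Sum.inl j)) = Xg (some (Sum.inl j)) * Xg (some (Sum.inl i))
  d_comm : ∀ i j : Fin n,
    Xg (some (Sum.inr i)) * Xg (some (Sum.inr j)) = Xg (some (Sum.inr j)) * Xg (some (Sum.inr i))
  dx_comm : ∀ i j : Fin n, i ≠ j →
    Xg (some (Sum.inr i)) * Xg (some (Sum.inl j)) = Xg (some (Sum.inl j)) * Xg (some (Sum.inr i))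
  dx_h : ∀ i : Fin n,
    Xg (some (Sum.inr i)) * Xg (some (Sum.inl i))
      = Xg (some (Sum.inl i)) * Xg (some (Sum.inr i)) + Xg none ^ 2
  /-- the total symbol map `Ψ_h` -/
  Psi : R ≃ₗ[K] Poly n K
  Psi_monomial : ∀ d : Mon n,
    Psi (Xg none ^ d none *
      ((List.ofFn fun i : Fin n => Xg (some (Sum.inl i)) ^ d (some (Sum.inl i))).prod *
       (List.ofFn fun i : Fin n => Xg (some (Sum.inr i)) ^ d (some (Sum.inr i))).prod)) =
    monomial d 1
  /-- the generating set `F = {f_1, …, f_N}` -/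
  F : Fin N → R
  F_hom : ∀ i, ∃ dF : ℕ, (Psi (F i)).IsHomogeneous dF

namespace Setting

variable {R : Type*} [Ring R] [Algebra K R] [NeZero N] (S : Setting n N K R)

/-- `ν : R^N → I`, `ν(a) = Σ a_i f_i`. -/
def nu (g : Fin N → R) : R := ∑ i, g i * S.F i

/-- The left ideal `I` generated by `F`. -/
def idl : Submodule R R := Submodule.span R (Set.range S.F)

/-- The componentwise total symbol map `Φ : R^N → K[h,x,ξ]^N`. -/
def Phi (g : Fin N → R) : Fin N → Poly n K := fun i => S.Psi (g i)

/-- The inverse total symbol of a monomial: the monomial `h^γ x^α ∂^β` of `R`. -/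
def monR (d : Mon n) : R := S.Psi.symm (monomial d 1)

/-- `t` is a term (nonzero coefficient times a monomial) of `R`. -/
def IsTermR (t : R) : Prop := ∃ (d : Mon n) (c : K), c ≠ 0 ∧ S.Psi t = monomial d c

/-- `≤_h`-leading monomial of an element of `R` (via its total symbol). -/
def LMr (f : R) : Mon n := LM S.D (S.Psi f)

/-- `≤_h`-leading coefficient of an element of `R`. -/
def LCr (f : R) : K := (S.Psi f).coeff (S.LMr f)

/-- `LT_h f ≤_h LT_h g` (strictly smaller, or equal monomials and equal valuations). -/
def leLT (f g : R) : Prop :=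
  ltTerm S.D (S.LCr f) (S.LMr f) (S.LCr g) (S.LMr g) ∨
    (S.D.val (S.LCr f) = S.D.val (S.LCr g) ∧ S.LMr f = S.LMr g)


/-- `m` is the leading monomial of the syzygy `a`: writing `m = (d, i)`,
`i` is the largest index with `a i ≠ 0` and `d = LM_h (a i)`. -/
def IsSyzLM (m : MMon n N) : Prop :=
  ∃ a : Fin N → R, S.nu a = 0 ∧ a m.2 ≠ 0 ∧ (∀ j, m.2 < j → a j = 0) ∧
    IsLM S.D (S.Psi (a m.2)) m.1

/-- `LSyz(F)`: the `K[h,x,ξ]`-submodule generated by leading monomials of syzygies. -/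
def LSyz : Submodule (Poly n K) (Fin N → Poly n K) :=
  Submodule.span _ { v | ∃ m : MMon n N, S.IsSyzLM m ∧ v = msingle m }

/-- Membership of a module monomial in `LSyz(F)`. -/
def inLSyz (m : MMon n N) : Prop := msingle m ∈ S.LSyz

/-- The strict total order `<_sign` on module monomials. -/
def ltSign (m m' : MMon n N) : Prop :=
  m.2 < m'.2 ∨ (m.2 = m'.2 ∧ (mdeg m.1 < mdeg m'.1 ∨ (mdeg m.1 = mdeg m'.1 ∧
    (wdeg S.D.w m.1 < wdeg S.D.w m'.1 ∨ (wdeg S.D.w m.1 = wdeg S.D.w m'.1 ∧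
      ((¬ S.inLSyz m ∧ S.inLSyz m') ∨
        ((S.inLSyz m ↔ S.inLSyz m') ∧ S.D.prec.lt (xiPart m.1) (xiPart m'.1))))))))

/-- `m` is the `≤_sign`-largest module monomial of `Φ(g)`. -/
def IsLMsign (g : Fin N → R) (m : MMon n N) : Prop :=
  m.1 ∈ (S.Psi (g m.2)).support ∧
    ∀ m' : MMon n N, m'.1 ∈ (S.Psi (g m'.2)).support → m' ≠ m → S.ltSign m' m

open Classical in
/-- `LM_sign(g)` (junk value if there is none). -/
def LMsign (g : Fin N → R) : MMon n N :=
  if h : ∃ m, S.IsLMsign g m then h.choose else ((0 : Mon n), (0 : Fin N))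

/-- `m` is the signature of `f`: the `≤_sign`-minimum of
`{LM_sign(g) : ν(g) = f}`. -/
def IsSig (f : R) (m : MMon n N) : Prop :=
  (∃ g : Fin N → R, S.nu g = f ∧ S.IsLMsign g m) ∧
    ∀ (g : Fin N → R) (m' : MMon n N), S.nu g = f → S.IsLMsign g m' → ¬ S.ltSign m' m

open Classical in
/-- The signature `s(f)` of `f ∈ I \ {0}` (junk value if there is none). -/
def sig (f : R) : MMon n N :=
  if h : ∃ m, S.IsSig f m then h.choose else ((0 : Mon n), (0 : Fin N))


/-- A module element is clean if `ν(g) ≠ 0` and no module monomial of `Φ(g)`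
belongs to `LSyz(F)`. -/
def Clean (g : Fin N → R) : Prop :=
  S.nu g ≠ 0 ∧ ∀ m : MMon n N, m.1 ∈ (S.Psi (g m.2)).support → ¬ S.inLSyz m

/-- `f` is `s`-top-reducible with respect to the module monomial `m`:
some `g ∈ I \ {0}` and term `t` satisfy `LM_h(t g) = LM_h(f)` and `s(t g) <_sign m`. -/
def sTopRed (f : R) (m : MMon n N) : Prop :=
  ∃ g ∈ S.idl, g ≠ 0 ∧ ∃ t : R, S.IsTermR t ∧
    S.LMr (t * g) = S.LMr f ∧ S.ltSign (S.sig (t * g)) m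

/-- `f` is `s`-top-irreducible with respect to `m`. -/
def sTopIrr (f : R) (m : MMon n N) : Prop := f = 0 ∨ ¬ S.sTopRed f m

/-- `σ` is the value `Ω(m)`: the `≤_sign`-minimum of
`{s(f) : f ∈ I \ {0}, LM_h(f) = m}`. -/
def IsOmega (m : Mon n) (σ : MMon n N) : Prop :=
  (∃ f, f ∈ S.idl ∧ f ≠ 0 ∧ S.LMr f = m ∧ S.sig f = σ) ∧
    ∀ f, f ∈ S.idl → f ≠ 0 → S.LMr f = m → ¬ S.ltSign (S.sig f) σ

open Classical in
/-- The map `Ω` (junk value if the minimum does not exist). -/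
def Omega (m : Mon n) : MMon n N :=
  if h : ∃ σ, S.IsOmega m σ then h.choose else ((0 : Mon n), (0 : Fin N))

/-- `G` is an `s`-Gröbner basis of `I`. -/
def IsSGB (G : Set R) : Prop :=
  G.Nonempty ∧ Submodule.span R G = S.idl ∧
    ∀ f ∈ S.idl, f ≠ 0 → S.sTopIrr f (S.sig f) →
      ∃ g ∈ G, ∃ d : Mon n,
        S.LMr (S.monR d * g) = S.LMr f ∧ mulM d (S.sig g) = S.sig f

/-- `G` is a (tropical) Gröbner basis of `I`:
`RG = I` and `⟨LM_h(G)⟩ = ⟨LM_h(I)⟩`. -/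
def IsGB (G : Set R) : Prop :=
  G.Nonempty ∧ Submodule.span R G = S.idl ∧
    Ideal.span ((fun g => (monomial (S.LMr g) 1 : Poly n K)) '' {g | g ∈ G ∧ g ≠ 0}) =
      Ideal.span ((fun g => (monomial (S.LMr g) 1 : Poly n K)) '' {f | f ∈ S.idl ∧ f ≠ 0})

/-- `g` is primitive `s`-top-irreducible. -/
def Primitive (g : R) : Prop :=
  g ∈ S.idl ∧ g ≠ 0 ∧ S.sTopIrr g (S.sig g) ∧
    ¬ ∃ g', g' ∈ S.idl ∧ g' ≠ 0 ∧ S.sTopIrr g' (S.sig g') ∧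
      ∃ d : Mon n, d ≠ 0 ∧ S.LMr (S.monR d * g') = S.LMr g ∧
        S.sig (S.monR d * g') = S.sig g

/-- `f` is redundant to `G`. -/
def Redundant (f : R) (G : Set R) : Prop :=
  f ≠ 0 ∧ ∃ g ∈ G, ∃ (d : Mon n) (c : K), c ≠ 0 ∧
    f = S.Psi.symm (monomial d c) * g ∧ S.ltSign (S.sig f) (mulM d (S.sig g))

/-- The cofactor `u_1` of the S-pair of `(g_1, g_2)`. -/
def u1 (g1 g2 : R) : R :=
  S.Psi.symm (monomial ((S.LMr g1 ⊔ S.LMr g2) - S.LMr g1) (S.LCr g2))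

/-- The cofactor `u_2` of the S-pair of `(g_1, g_2)`. -/
def u2 (g1 g2 : R) : R :=
  S.Psi.symm (monomial ((S.LMr g1 ⊔ S.LMr g2) - S.LMr g2) (S.LCr g1))

/-- The S-pair `spair(g_1, g_2) = u_1 g_1 - u_2 g_2`. -/
def spair (g1 g2 : R) : R := S.u1 g1 g2 * g1 - S.u2 g1 g2 * g2

/-- `(g_1, g_2)` is a normal pair relative to `G`. -/
def NormalPair (G : Set R) (g1 g2 : R) : Prop :=
  S.Primitive g1 ∧ S.Primitive g2 ∧
    S.sig (S.u1 g1 g2 * g1) = mulM ((S.LMr g1 ⊔ S.LMr g2) - S.LMr g1) (S.sig g1) ∧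
    S.sig (S.u2 g1 g2 * g2) = mulM ((S.LMr g1 ⊔ S.LMr g2) - S.LMr g2) (S.sig g2) ∧
    S.sig (S.u1 g1 g2 * g1) ≠ S.sig (S.u2 g1 g2 * g2) ∧
    ¬ S.Redundant (S.spair g1 g2) G

end Setting

end TropF5

namespace TropF5

section TropicalOrder

variable {n N : ℕ} {K : Type*} [Field K]

theorem mdeg_eq_degree (d : Mon n) : mdeg d = d.degree := rfl

theorem mdeg_eq_sum (d : Mon n) : mdeg d = d none + ∑ j : Fin n ⊕ Fin n, d (some j) := by
  rw [mdeg, Finsupp.sum_fintype _ _ (fun _ => rfl), Fintype.sum_option]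

theorem mdeg_add (d e : Mon n) : mdeg (d + e) = mdeg d + mdeg e := by
  simp [mdeg_eq_degree]

theorem wdeg_add (w : Fin n ⊕ Fin n → ℝ) (d e : Mon n) :
    wdeg w (d + e) = wdeg w d + wdeg w e := by
  simp [wdeg, mul_add, Finset.sum_add_distrib]

theorem xiPart_add (d e : Mon n) : xiPart (d + e) = xiPart d + xiPart e := by
  ext j; simp [xiPart]

theorem eq_of_xiPart_eq {d e : Mon n} (h : xiPart d = xiPart e) (hdeg : mdeg d = mdeg e) :
    d = e := by
  have h' : ∀ j, d (some j) = e (some j) := fun j => by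
    simpa [xiPart] using DFunLike.congr_fun h j
  rw [mdeg_eq_sum, mdeg_eq_sum, Finset.sum_congr rfl fun j _ => h' j] at hdeg
  ext (_ | j)
  · omega
  · exact h' j

theorem finite_mdeg_le (k : ℕ) : {d : Mon n | mdeg d ≤ k}.Finite :=
  Finsupp.finite_of_degree_le k

theorem OrdData.prec_trans (D : OrdData n K) {u v t : (Fin n ⊕ Fin n) →₀ ℕ}
    (h : D.prec.lt u v) (h' : D.prec.lt v t) : D.prec.lt u t :=
  @lt_trans _ D.prec.toPreorder _ _ _ h h'

theorem OrdData.prec_irrefl (D : OrdData n K) (u : (Fin n ⊕ Fin n) →₀ ℕ) : ¬ D.prec.lt u u :=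
  @lt_irrefl _ D.prec.toPreorder u

theorem OrdData.prec_trichotomy (D : OrdData n K) (u v : (Fin n ⊕ Fin n) →₀ ℕ) :
    D.prec.lt u v ∨ u = v ∨ D.prec.lt v u :=
  @lt_trichotomy _ D.prec u v

theorem ltTerm_irrefl (D : OrdData n K) (a : K) (d : Mon n) : ¬ ltTerm D a d a d := by
  simp [ltTerm, D.prec_irrefl]

theorem ltTerm_trans (D : OrdData n K) {a b c : K} {d e f : Mon n}
    (h : ltTerm D a d b e) (h' : ltTerm D b e c f) : ltTerm D a d c f := by
  rcases h with h | ⟨h1, h | ⟨h2, h | ⟨h3, h⟩⟩⟩ <;>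
    rcases h' with h' | ⟨h1', h' | ⟨h2', h' | ⟨h3', h'⟩⟩⟩
  all_goals first
    | exact Or.inl (by omega)
    | exact Or.inr ⟨by omega, Or.inl (by linarith)⟩
    | exact Or.inr ⟨by omega, Or.inr ⟨by linarith, Or.inl (by linarith)⟩⟩
    | exact Or.inr ⟨by omega, Or.inr ⟨by linarith, Or.inr ⟨by linarith, D.prec_trans h h'⟩⟩⟩

theorem ltTerm_trichotomy (D : OrdData n K) (a b : K) {d e : Mon n} (hde : d ≠ e) :
    ltTerm D a d b e ∨ ltTerm D b e a d := by
  unfold ltTerm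
  rcases lt_trichotomy (mdeg d) (mdeg e) with h | h | h
  · exact Or.inl (Or.inl h)
  · rcases lt_trichotomy (wdeg D.w d) (wdeg D.w e) with h1 | h1 | h1
    · exact Or.inl (Or.inr ⟨h, Or.inl h1⟩)
    · rcases lt_trichotomy (-D.val a + wdeg D.om d) (-D.val b + wdeg D.om e) with h2 | h2 | h2
      · exact Or.inl (Or.inr ⟨h, Or.inr ⟨h1, Or.inl h2⟩⟩)
      · rcases D.prec_trichotomy (xiPart d) (xiPart e) with h3 | h3 | h3
        · exact Or.inl (Or.inr ⟨h, Or.inr ⟨h1, Or.inr ⟨h2, h3⟩⟩⟩)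
        · exact absurd (eq_of_xiPart_eq h3 h) hde
        · exact Or.inr (Or.inr ⟨h.symm, Or.inr ⟨h1.symm, Or.inr ⟨h2.symm, h3⟩⟩⟩)
      · exact Or.inr (Or.inr ⟨h.symm, Or.inr ⟨h1.symm, Or.inl h2⟩⟩)
    · exact Or.inr (Or.inr ⟨h.symm, Or.inl h1⟩)
  · exact Or.inr (Or.inl h)

theorem ltTerm_add_left (D : OrdData n K) {a b : K} {d e : Mon n} (t : Mon n)
    (h : ltTerm D a d b e) : ltTerm D a (t + d) b (t + e) := by
  unfold ltTerm at *
  simp only [mdeg_add, wdeg_add, xiPart_add]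
  rcases h with h | ⟨h1, h | ⟨h2, h | ⟨h3, h⟩⟩⟩
  · exact Or.inl (by omega)
  · exact Or.inr ⟨by omega, Or.inl (by linarith)⟩
  · exact Or.inr ⟨by omega, Or.inr ⟨by linarith, Or.inl (by linarith)⟩⟩
  · refine Or.inr ⟨by omega, Or.inr ⟨by linarith, Or.inr ⟨by linarith, ?_⟩⟩⟩
    rw [add_comm (xiPart t), add_comm (xiPart t)]
    exact D.prec_add _ _ _ h

theorem ltTerm_mul_left (D : OrdData n K) {a b c : K} {d e : Mon n} (ha : a ≠ 0) (hb : b ≠ 0)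
    (hc : c ≠ 0) (h : ltTerm D a d b e) : ltTerm D (c * a) d (c * b) e := by
  unfold ltTerm at *
  rw [D.val_mul c a hc ha, D.val_mul c b hc hb]
  rcases h with h | ⟨h1, h | ⟨h2, h | ⟨h3, h⟩⟩⟩
  · exact Or.inl h
  · exact Or.inr ⟨h1, Or.inl h⟩
  · exact Or.inr ⟨h1, Or.inr ⟨h2, Or.inl (by linarith)⟩⟩
  · exact Or.inr ⟨h1, Or.inr ⟨h2, Or.inr ⟨by linarith, h⟩⟩⟩

theorem mdeg_lt_or_of_ltTerm (D : OrdData n K) {a b : K} {d e : Mon n} (h : ltTerm D a d b e) :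
    mdeg d < mdeg e ∨ (mdeg d = mdeg e ∧ wdeg D.w d ≤ wdeg D.w e) := by
  rcases h with h | ⟨h1, h | ⟨h2, -⟩⟩
  · exact Or.inl h
  · exact Or.inr ⟨h1, h.le⟩
  · exact Or.inr ⟨h1, h2.le⟩

theorem val_lt_of_ltTerm_self (D : OrdData n K) {a b : K} {d : Mon n} (h : ltTerm D a d b d) :
    D.val b < D.val a := by
  rcases h with h | ⟨-, h | ⟨-, h | ⟨-, h⟩⟩⟩
  · exact absurd h (lt_irrefl _)
  · exact absurd h (lt_irrefl _)
  · linarith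
  · exact absurd h (D.prec_irrefl _)

theorem val_neg (D : OrdData n K) {a : K} (ha : a ≠ 0) : D.val (-a) = D.val a := by
  have h1 := D.val_mul 1 1 one_ne_zero one_ne_zero
  have h2 := D.val_mul (-1) (-1) (by simp) (by simp)
  have h3 := D.val_mul (-1) a (by simp) ha
  simp only [mul_one, neg_mul, one_mul, mul_neg, neg_neg] at h1 h2 h3
  linarith

theorem sum_eq_zero_or_lt_val (D : OrdData n K) {ι : Type*} (s : Finset ι) (f : ι → K) (t : ℝ)
    (h : ∀ i ∈ s, f i = 0 ∨ t < D.val (f i)) :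
    ∑ i ∈ s, f i = 0 ∨ t < D.val (∑ i ∈ s, f i) := by
  refine Finset.sum_induction f (fun x => x = 0 ∨ t < D.val x) ?_ (Or.inl rfl) h
  rintro a b (rfl | ha) (rfl | hb)
  · simp
  · simp [hb]
  · simp [ha]
  · by_cases ha0 : a = 0
    · subst ha0; simp [hb]
    by_cases hb0 : b = 0
    · subst hb0; simp [ha]
    by_cases hab : a + b = 0
    · exact Or.inl hab
    · exact Or.inr ((lt_min ha hb).trans_le (D.val_add a b ha0 hb0 hab))

/-- A nonempty finite set has a greatest element for a strict total order on it. -/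
theorem exists_greatest_of_finite {α : Type*} {r : α → α → Prop} {s : Set α} (hs : s.Finite)
    (hne : s.Nonempty) (irrefl : ∀ x, ¬ r x x) (trans : ∀ x y z, r x y → r y z → r x z)
    (total : ∀ x ∈ s, ∀ y ∈ s, x ≠ y → r x y ∨ r y x) :
    ∃ m ∈ s, ∀ x ∈ s, x ≠ m → r x m := by
  have : IsStrictOrder α (Function.swap r) :=
    { irrefl := irrefl, trans := fun a b c h h' => trans _ _ _ h' h }
  have hwf := hs.wellFoundedOn (r := Function.swap r)
  obtain ⟨⟨m, hm⟩, -, hmin⟩ := hwf.has_min Set.univ ⟨⟨hne.some, hne.some_mem⟩, trivial⟩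
  refine ⟨m, hm, fun x hx hxm => ?_⟩
  exact (total x hx m hm hxm).resolve_right fun h => hmin ⟨x, hx⟩ trivial h

theorem exists_isLM (D : OrdData n K) {p : Poly n K} (hp : p ≠ 0) : ∃ d, IsLM D p d := by
  obtain ⟨m, hm, hmax⟩ := exists_greatest_of_finite (s := (p.support : Set (Mon n)))
    (r := fun d e => ltTerm D (p.coeff d) d (p.coeff e) e) p.support.finite_toSet
    (by simpa [Finset.nonempty_iff_ne_empty] using hp) (fun d => ltTerm_irrefl D _ d)
    (fun _ _ _ => ltTerm_trans D) (fun d _ e _ h => ltTerm_trichotomy D _ _ h)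
  exact ⟨m, hm, hmax⟩

theorem IsLM.unique {D : OrdData n K} {p : Poly n K} {d e : Mon n} (hd : IsLM D p d)
    (he : IsLM D p e) : d = e := by
  by_contra h
  exact ltTerm_irrefl D _ _ (ltTerm_trans D (hd.2 e he.1 (Ne.symm h)) (he.2 d hd.1 h))

theorem IsLM.LM_eq {D : OrdData n K} {p : Poly n K} {d : Mon n} (h : IsLM D p d) :
    LM D p = d := by
  have hex : ∃ d, IsLM D p d := ⟨d, h⟩
  rw [LM, dif_pos hex]
  exact hex.choose_spec.unique h

theorem isLM_LM (D : OrdData n K) {p : Poly n K} (hp : p ≠ 0) : IsLM D p (LM D p) := by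
  obtain ⟨d, hd⟩ := exists_isLM D hp
  rwa [hd.LM_eq]

theorem IsLM.ne_zero {D : OrdData n K} {p : Poly n K} {d : Mon n} (h : IsLM D p d) : p ≠ 0 := by
  rintro rfl
  simpa using h.1

/-- The set of leading monomials of the elements of a linear subspace. -/
def lmSet (D : OrdData n K) (V : Submodule K (Poly n K)) : Set (Mon n) :=
  {d | ∃ p ∈ V, IsLM D p d}

theorem lmSet_mono (D : OrdData n K) {V W : Submodule K (Poly n K)} (h : V ≤ W) :
    lmSet D V ⊆ lmSet D W :=
  fun _ ⟨p, hp, hd⟩ => ⟨p, h hp, hd⟩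

/-- Polynomials with pairwise distinct leading monomials are linearly independent. -/
theorem linearIndependent_of_isLM (D : OrdData n K) {ι : Type*} (v : ι → Poly n K)
    (m : ι → Mon n) (hm : Function.Injective m) (h : ∀ i, IsLM D (v i) (m i)) :
    LinearIndependent K v := by
  classical
  rw [linearIndependent_iff']
  intro s c hsum
  by_contra! hne
  obtain ⟨i₀, hi₀, hci₀⟩ := hne
  have hlc : ∀ i, (v i).coeff (m i) ≠ 0 := fun i => mem_support_iff.1 (h i).1
  obtain ⟨i, ⟨his, hci⟩, hmax⟩ := exists_greatest_of_finite
    (s := {i | i ∈ s ∧ c i ≠ 0})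
    (r := fun i j => ltTerm D (c i * (v i).coeff (m i)) (m i) (c j * (v j).coeff (m j)) (m j))
    (s.finite_toSet.subset fun _ hi => hi.1) ⟨i₀, hi₀, hci₀⟩
    (fun _ => ltTerm_irrefl D _ _) (fun _ _ _ => ltTerm_trans D)
    (fun _ _ _ _ hij => ltTerm_trichotomy D _ _ (hm.ne hij))
  have hcoeff := congrArg (coeff (m i)) hsum
  rw [coeff_sum, ← Finset.add_sum_erase _ _ his, coeff_zero, coeff_smul, smul_eq_mul] at hcoeff
  have hrest := sum_eq_zero_or_lt_val D (s.erase i) (fun j => coeff (m i) (c j • v j))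
    (D.val (c i * (v i).coeff (m i))) (by
      intro j hj
      obtain ⟨hji, hjs⟩ := Finset.mem_erase.1 hj
      rw [coeff_smul, smul_eq_mul]
      by_cases hcj : c j = 0
      · simp [hcj]
      by_cases hvj : (v j).coeff (m i) = 0
      · simp [hvj]
      refine Or.inr (val_lt_of_ltTerm_self D (d := m i) ?_)
      refine ltTerm_trans D (ltTerm_mul_left D hvj (hlc j) hcj
        ((h j).2 (m i) (mem_support_iff.2 hvj) (hm.ne hji.symm))) (hmax j ⟨hjs, hcj⟩ hji))
  have hne : c i * (v i).coeff (m i) ≠ 0 := mul_ne_zero hci (hlc i)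
  rcases hrest with h0 | hlt
  · rw [h0, add_zero] at hcoeff
    exact hne hcoeff
  · rw [eq_neg_of_add_eq_zero_right hcoeff, val_neg D hne] at hlt
    exact lt_irrefl _ hlt

/-- The coefficients of a polynomial at a set of monomials. -/
def coeffsAt (s : Set (Mon n)) : Poly n K →ₗ[K] (s → K) :=
  LinearMap.pi fun d => lcoeff K d.1

theorem injective_coeffsAt_lmSet (D : OrdData n K) (V : Submodule K (Poly n K)) :
    Function.Injective ((coeffsAt (lmSet D V)).domRestrict V) := by
  rw [← LinearMap.ker_eq_bot, LinearMap.ker_eq_bot']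
  rintro ⟨p, hp⟩ h
  by_contra hne
  obtain ⟨d, hd⟩ := exists_isLM D (p := p) (by simpa using hne)
  exact mem_support_iff.1 hd.1 (congrFun h ⟨d, p, hp, hd⟩)

theorem finite_lmSet (D : OrdData n K) (V : Submodule K (Poly n K)) [FiniteDimensional K V] :
    (lmSet D V).Finite ∧ Module.finrank K V = (lmSet D V).ncard := by
  choose v hv hlm using fun d : lmSet D V => d.2
  have hli : LinearIndependent K (fun d => (⟨v d, hv d⟩ : V)) :=
    LinearIndependent.of_comp V.subtype
      (linearIndependent_of_isLM D v _ Subtype.val_injective hlm)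
  have hfin : Finite (lmSet D V) := hli.finite
  have := Fintype.ofFinite (lmSet D V)
  refine ⟨Set.toFinite _, le_antisymm ?_ ?_⟩
  · have := LinearMap.finrank_le_finrank_of_injective (injective_coeffsAt_lmSet D V)
    rwa [Module.finrank_fintype_fun_eq_card, ← Nat.card_eq_fintype_card,
      Nat.card_coe_set_eq] at this
  · have := hli.fintype_card_le_finrank
    rwa [← Nat.card_eq_fintype_card, Nat.card_coe_set_eq] at this

/-- A finite-dimensional space contains, for each of its leading monomials, an element whose
other monomials are not leading monomials of the space. -/
theorem exists_reduced (D : OrdData n K) (V : Submodule K (Poly n K)) [FiniteDimensional K V]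
    {d : Mon n} (hd : d ∈ lmSet D V) :
    ∃ p ∈ V, p.coeff d = 1 ∧ ∀ e ∈ p.support, e ≠ d → e ∉ lmSet D V := by
  classical
  obtain ⟨hfin, hcard⟩ := finite_lmSet D V
  have := hfin.fintype
  have hsurj := (LinearMap.injective_iff_surjective_of_finrank_eq_finrank (by
    rw [Module.finrank_fintype_fun_eq_card, hcard, ← Nat.card_eq_fintype_card,
      Nat.card_coe_set_eq])).1 (injective_coeffsAt_lmSet D V)
  obtain ⟨⟨p, hp⟩, h⟩ := hsurj (Pi.single ⟨d, hd⟩ 1)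
  have h' : ∀ e : lmSet D V,
      p.coeff e.1 = Pi.single (M := fun _ : lmSet D V => K) ⟨d, hd⟩ 1 e :=
    fun e => congrFun h e
  refine ⟨p, hp, by simpa using h' ⟨d, hd⟩, fun e he hed hmem => mem_support_iff.1 he ?_⟩
  rw [h' ⟨e, hmem⟩, Pi.single_eq_of_ne (by simpa using hed)]

theorem isLM_homogeneousComponent {D : OrdData n K} {p : Poly n K} {d : Mon n}
    (h : IsLM D p d) : IsLM D (homogeneousComponent (mdeg d) p) d := by
  have hsupp : ∀ e, e ∈ (homogeneousComponent (mdeg d) p).support →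
      e ∈ p.support ∧ mdeg e = mdeg d := by
    intro e he
    rw [mem_support_iff, coeff_homogeneousComponent] at he
    split_ifs at he with hdeg
    · exact ⟨mem_support_iff.2 he, hdeg⟩
    · exact absurd rfl he
  have hcoeff : ∀ e, mdeg e = mdeg d →
      (homogeneousComponent (mdeg d) p).coeff e = p.coeff e := by
    intro e he
    rw [coeff_homogeneousComponent, ← mdeg_eq_degree, if_pos he]
  refine ⟨?_, fun e he hed => ?_⟩
  · rw [mem_support_iff, hcoeff d rfl]
    exact mem_support_iff.1 h.1
  · obtain ⟨he1, he2⟩ := hsupp e he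
    rw [hcoeff d rfl, hcoeff e he2]
    exact h.2 e he1 hed

end TropicalOrder

section OrderedProducts

theorem mul_prod_ofFn_pow {M : Type*} [Monoid M] {n : ℕ} (f : Fin n → M)
    (hf : ∀ i j, f i * f j = f j * f i) (a : Fin n → ℕ) (i : Fin n) :
    f i * (List.ofFn fun j => f j ^ a j).prod =
      (List.ofFn fun j => f j ^ ((Pi.single i 1 : Fin n → ℕ) j + a j)).prod := by
  induction n with
  | zero => exact i.elim0
  | succ n ih =>
    rw [List.ofFn_succ, List.ofFn_succ, List.prod_cons, List.prod_cons]
    refine Fin.cases ?_ (fun i => ?_) i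
    · simp [pow_add, mul_assoc]
    · have hcomm : f i.succ * f 0 ^ a 0 = f 0 ^ a 0 * f i.succ :=
        Commute.pow_right (hf i.succ 0) _
      have := ih (fun j => f j.succ) (fun _ _ => hf _ _) (fun j => a j.succ) i
      rw [← mul_assoc, hcomm, mul_assoc, this]
      simp [Pi.single_apply]

theorem mul_pow_of_mul_eq_add {A : Type*} [Ring A] {D f z : A} (hz : Commute z f)
    (hD : D * f = f * D + z) (k : ℕ) :
    D * f ^ k = f ^ k * D + (k : A) * (f ^ (k - 1) * z) := by
  induction k with
  | zero => simp
  | succ k ih =>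
    have hk : (k : A) * (f ^ (k - 1) * (z * f)) = (k : A) * (f ^ k * z) := by
      rcases k with _ | k
      · simp
      · rw [hz.eq, Nat.add_sub_cancel, pow_succ, mul_assoc]
    rw [pow_succ, ← mul_assoc, ih, add_mul, mul_assoc, hD]
    simp only [mul_assoc, Nat.cast_add, Nat.cast_one, Nat.add_sub_cancel, mul_add, add_mul,
      one_mul, hk]
    abel

theorem mul_prod_ofFn_pow_of_mul_eq_add {A : Type*} [Ring A] {n : ℕ} (f : Fin n → A) (D z : A)
    (i : Fin n) (hz : ∀ j, Commute z (f j)) (hD : ∀ j, j ≠ i → Commute D (f j))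
    (hDi : D * f i = f i * D + z) (a : Fin n → ℕ) :
    D * (List.ofFn fun j => f j ^ a j).prod =
      (List.ofFn fun j => f j ^ a j).prod * D +
        (a i : A) * ((List.ofFn fun j => f j ^ (a j - (Pi.single i 1 : Fin n → ℕ) j)).prod * z) := by
  induction n with
  | zero => exact i.elim0
  | succ n ih =>
    rw [List.ofFn_succ, List.ofFn_succ, List.prod_cons, List.prod_cons]
    revert hD hDi
    refine Fin.cases (fun hD hDi => ?_) (fun i hD hDi => ?_) i
    · have hrest : ∀ y, (∀ j : Fin n, Commute y (f j.succ)) →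
          y * (List.ofFn fun j : Fin n => f j.succ ^ a j.succ).prod =
            (List.ofFn fun j : Fin n => f j.succ ^ a j.succ).prod * y := by
        intro y hy
        refine Commute.list_prod_right _ _ fun x hx => ?_
        obtain ⟨j, rfl⟩ := (List.mem_ofFn' _ _).1 hx
        exact (hy j).pow_right _
      rw [← mul_assoc, mul_pow_of_mul_eq_add (hz 0) hDi, add_mul, mul_assoc (f 0 ^ a 0),
        hrest D fun j => hD _ (Fin.succ_ne_zero j)]
      simp only [mul_assoc]
      rw [hrest z fun j => hz _]
      simp
    · have hcomm : D * f 0 ^ a 0 = f 0 ^ a 0 * D :=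
        Commute.pow_right (hD 0 (Fin.succ_ne_zero i).symm) _
      have := ih (fun j => f j.succ) i (fun _ => hz _)
        (fun j hj => hD _ (by simpa using hj)) hDi (fun j => a j.succ)
      rw [← mul_assoc, hcomm, mul_assoc, this, mul_add, ← mul_assoc, ← mul_assoc (f 0 ^ a 0),
        ← (Nat.cast_commute (a i.succ) (f 0 ^ a 0)).eq]
      simp [Pi.single_apply, mul_assoc]

end OrderedProducts

namespace Setting

section Multiplication

variable {n N : ℕ} {K : Type*} [Field K] {R : Type*} [Ring R] [Algebra K R]
  (S : Setting n N K R)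

theorem Psi_monR (d : Mon n) : S.Psi (S.monR d) = monomial d 1 := S.Psi.apply_symm_apply _

theorem monR_eq (d : Mon n) :
    S.monR d = S.Xg none ^ d none *
      ((List.ofFn fun i : Fin n => S.Xg (some (Sum.inl i)) ^ d (some (Sum.inl i))).prod *
       (List.ofFn fun i : Fin n => S.Xg (some (Sum.inr i)) ^ d (some (Sum.inr i))).prod) :=
  S.Psi.injective (by rw [S.Psi_monomial, S.Psi_monR])

theorem Xg_none_mul_monR (d : Mon n) :
    S.Xg none * S.monR d = S.monR (Finsupp.single none 1 + d) := by
  simp [monR_eq, pow_add, mul_assoc]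

theorem Xg_inl_mul_monR (i : Fin n) (d : Mon n) :
    S.Xg (some (Sum.inl i)) * S.monR d =
      S.monR (Finsupp.single (some (Sum.inl i)) 1 + d) := by
  have h : S.Xg (some (Sum.inl i)) * S.Xg none ^ d none =
      S.Xg none ^ d none * S.Xg (some (Sum.inl i)) :=
    Commute.pow_right (S.h_comm _).symm _
  rw [monR_eq, monR_eq, ← mul_assoc, h, mul_assoc, ← mul_assoc (S.Xg (some (Sum.inl i))),
    mul_prod_ofFn_pow (fun j => S.Xg (some (Sum.inl j))) S.x_comm]
  simp [Finsupp.single_apply, Pi.single_apply, eq_comm]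

theorem Xg_inr_mul_monR (i : Fin n) (d : Mon n) :
    S.Xg (some (Sum.inr i)) * S.monR d =
      S.monR (Finsupp.single (some (Sum.inr i)) 1 + d) +
        (d (some (Sum.inl i)) : R) *
          S.monR (Finsupp.single none 2 + d - Finsupp.single (some (Sum.inl i)) 1) := by
  have hh : ∀ v k, S.Xg v * S.Xg none ^ k = S.Xg none ^ k * S.Xg v :=
    fun v k => Commute.pow_right (S.h_comm _).symm _
  have hD := mul_prod_ofFn_pow_of_mul_eq_add (fun j => S.Xg (some (Sum.inl j)))
    (S.Xg (some (Sum.inr i))) (S.Xg none ^ 2) i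
    (fun j => (hh (some (Sum.inl j)) 2).symm) (fun j hj => S.dx_comm i j hj.symm) (S.dx_h i)
    (fun j => d (some (Sum.inl j)))
  have hB := mul_prod_ofFn_pow (fun j => S.Xg (some (Sum.inr j))) S.d_comm
    (fun j => d (some (Sum.inr j))) i
  set P := (List.ofFn fun j : Fin n => S.Xg (some (Sum.inl j)) ^
    (d (some (Sum.inl j)) - (Pi.single i 1 : Fin n → ℕ) j)).prod with hP
  have hcomm : P * S.Xg none ^ 2 = S.Xg none ^ 2 * P := by
    refine Commute.list_prod_left _ _ fun x hx => ?_
    obtain ⟨j, rfl⟩ := (List.mem_ofFn' _ _).1 hx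
    exact (Commute.pow_left (hh _ 2) _)
  have h2 : S.monR (Finsupp.single none 2 + d - Finsupp.single (some (Sum.inl i)) 1) =
      S.Xg none ^ d none * (S.Xg none ^ 2 * (P *
        (List.ofFn fun i : Fin n => S.Xg (some (Sum.inr i)) ^ d (some (Sum.inr i))).prod)) := by
    rw [monR_eq, hP, ← mul_assoc (S.Xg none ^ d none), ← pow_add]
    simp [Finsupp.single_apply, Pi.single_apply, eq_comm, add_comm]
  have h1 : S.monR (Finsupp.single (some (Sum.inr i)) 1 + d) = S.Xg none ^ d none *
      ((List.ofFn fun i : Fin n => S.Xg (some (Sum.inl i)) ^ d (some (Sum.inl i))).prod *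
       (S.Xg (some (Sum.inr i)) *
        (List.ofFn fun i : Fin n => S.Xg (some (Sum.inr i)) ^ d (some (Sum.inr i))).prod)) := by
    rw [monR_eq, hB]
    simp [Finsupp.single_apply, Pi.single_apply, eq_comm]
  rw [h1, h2, monR_eq, ← mul_assoc, hh, mul_assoc, ← mul_assoc (S.Xg (some (Sum.inr i))), hD,
    hcomm, add_mul, mul_add, mul_assoc, mul_assoc, mul_assoc, ← mul_assoc (S.Xg none ^ d none)
    (d (some (Sum.inl i)) : R), ← (Nat.cast_commute (d (some (Sum.inl i))) _).eq, mul_assoc]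

theorem wdeg_single_some (w : Fin n ⊕ Fin n → ℝ) (j : Fin n ⊕ Fin n) (k : ℕ) :
    wdeg w (Finsupp.single (some j) k) = w j * k := by
  classical
  simp [wdeg, Finsupp.single_apply]

theorem wdeg_single_none (w : Fin n ⊕ Fin n → ℝ) (k : ℕ) :
    wdeg w (Finsupp.single none k) = 0 := by
  simp [wdeg]

theorem mdeg_single (v : Vars n) (k : ℕ) : mdeg (Finsupp.single v k) = k := by
  simp [mdeg_eq_degree]

theorem Psi_Xg_mul_monR (v : Vars n) (d : Mon n) :
    ∃ q : Poly n K, S.Psi (S.Xg v * S.monR d) = monomial (Finsupp.single v 1 + d) 1 + q ∧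
      ∀ e ∈ q.support, mdeg e = 1 + mdeg d ∧
        wdeg S.D.w e < wdeg S.D.w (Finsupp.single v 1 + d) := by
  rcases v with _ | i | i
  · exact ⟨0, by rw [Xg_none_mul_monR, Psi_monR, add_zero], by simp⟩
  · exact ⟨0, by rw [Xg_inl_mul_monR, Psi_monR, add_zero], by simp⟩
  · set e₀ : Mon n := Finsupp.single none 2 + d - Finsupp.single (some (Sum.inl i)) 1 with he₀
    refine ⟨monomial e₀ (d (some (Sum.inl i)) : K), ?_, ?_⟩
    · have : (d (some (Sum.inl i)) : R) * S.monR e₀ = (d (some (Sum.inl i)) : K) • S.monR e₀ := by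
        rw [Algebra.smul_def, map_natCast]
      rw [Xg_inr_mul_monR, map_add, Psi_monR, this, map_smul, Psi_monR, smul_monomial,
        smul_eq_mul, mul_one]
    · intro e he
      rw [mem_support_iff, coeff_monomial] at he
      split_ifs at he with h
      · subst h
        have hpos : d (some (Sum.inl i)) ≠ 0 := fun h0 => he (by simp [h0])
        have hsum : Finsupp.single (some (Sum.inl i)) 1 + e₀ = Finsupp.single none 2 + d := by
          rw [he₀]
          refine add_tsub_cancel_of_le (le_trans ?_ (self_le_add_left _ _))
          rw [Finsupp.single_le_iff]
          omega
        have h1 := congrArg mdeg hsum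
        have h2 := congrArg (wdeg S.D.w) hsum
        simp only [mdeg_add, mdeg_single] at h1
        simp only [wdeg_add, wdeg_single_some, wdeg_single_none] at h2 ⊢
        have h3 := S.D.w_nonneg i
        have h4 := S.D.w_big i i
        push_cast at h2 ⊢
        exact ⟨by omega, by linarith⟩
      · exact absurd rfl he

theorem sum_coeff_smul_monR (a : R) :
    a = ∑ d ∈ (S.Psi a).support, (S.Psi a).coeff d • S.monR d := by
  apply S.Psi.injective
  rw [map_sum]
  simp only [map_smul, Psi_monR, smul_monomial, smul_eq_mul, mul_one]
  exact (S.Psi a).as_sum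

/-- Left multiplication by a generator, up to terms of lower `w`-weight. -/
theorem Psi_Xg_mul (v : Vars n) (a : R) :
    ∃ q : Poly n K, S.Psi (S.Xg v * a) = monomial (Finsupp.single v 1) 1 * S.Psi a + q ∧
      ∀ e ∈ q.support, ∃ d ∈ (S.Psi a).support, mdeg e = 1 + mdeg d ∧
        wdeg S.D.w e < wdeg S.D.w (Finsupp.single v 1 + d) := by
  classical
  choose q hq hsupp using S.Psi_Xg_mul_monR v
  refine ⟨∑ d ∈ (S.Psi a).support, (S.Psi a).coeff d • q d, ?_, fun e he => ?_⟩
  · conv_lhs => rw [S.sum_coeff_smul_monR a]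
    conv_rhs => rw [(S.Psi a).as_sum]
    rw [Finset.mul_sum, map_sum, Finset.mul_sum, ← (S.Psi a).as_sum, ← Finset.sum_add_distrib]
    refine Finset.sum_congr rfl fun d _ => ?_
    rw [mul_smul_comm, map_smul, hq, smul_add, smul_monomial, monomial_mul, one_mul, smul_eq_mul,
      mul_one]
  · obtain ⟨d, hd, hed⟩ := Finset.mem_biUnion.1 (support_sum he)
    exact ⟨d, hd, hsupp d e (support_smul hed)⟩

theorem isLM_Xg_mul (v : Vars n) {a : R} {d : Mon n} (h : IsLM S.D (S.Psi a) d) :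
    IsLM S.D (S.Psi (S.Xg v * a)) (Finsupp.single v 1 + d) := by
  obtain ⟨q, hq, hsupp⟩ := S.Psi_Xg_mul v a
  have hlow : ∀ e ∈ q.support, mdeg e < mdeg (Finsupp.single v 1 + d) ∨
      (mdeg e = mdeg (Finsupp.single v 1 + d) ∧
        wdeg S.D.w e < wdeg S.D.w (Finsupp.single v 1 + d)) := by
    intro e he
    obtain ⟨d', hd', hdeg, hw⟩ := hsupp e he
    rw [mdeg_add, mdeg_single]
    rw [wdeg_add] at hw ⊢
    by_cases hdd : d' = d
    · subst hdd
      exact Or.inr ⟨hdeg, hw⟩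
    · rcases mdeg_lt_or_of_ltTerm _ (h.2 d' hd' hdd) with h1 | ⟨h1, h2⟩
      · exact Or.inl (by omega)
      · exact Or.inr ⟨by omega, by linarith⟩
  have hcoeff : ∀ d', d' ∉ q.support →
      (S.Psi (S.Xg v * a)).coeff d' = (monomial (Finsupp.single v 1) 1 * S.Psi a).coeff d' := by
    intro d' hd'
    rw [hq, coeff_add, notMem_support_iff.1 hd', add_zero]
  have hlead : (S.Psi (S.Xg v * a)).coeff (Finsupp.single v 1 + d) = (S.Psi a).coeff d := by
    rw [hcoeff, coeff_monomial_mul, one_mul]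
    intro hmem
    rcases hlow _ hmem with h1 | ⟨-, h1⟩ <;> exact lt_irrefl _ h1
  refine ⟨by rw [mem_support_iff, hlead]; exact mem_support_iff.1 h.1, fun e he hed => ?_⟩
  by_cases hqe : e ∈ q.support
  · rcases hlow e hqe with h1 | ⟨h1, h2⟩
    · exact Or.inl h1
    · exact Or.inr ⟨h1, Or.inl h2⟩
  · rw [mem_support_iff, hcoeff e hqe, coeff_monomial_mul'] at he
    split_ifs at he with hle
    · obtain ⟨d', rfl⟩ := exists_add_of_le hle
      rw [add_tsub_cancel_left, one_mul] at he
      rw [hlead, hcoeff _ hqe, coeff_monomial_mul, one_mul]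
      exact ltTerm_add_left _ _ (h.2 d' (mem_support_iff.2 he) fun h => hed (by rw [h]))
    · exact absurd rfl he

/-- For every monomial there is a left multiplication shifting leading monomials by it. -/
theorem exists_shift (e : Mon n) : ∃ r : R, ∀ (a : R) (d : Mon n), IsLM S.D (S.Psi a) d →
    IsLM S.D (S.Psi (r * a)) (e + d) := by
  induction e using Finsupp.induction_linear with
  | zero => exact ⟨1, fun a d h => by rwa [one_mul, zero_add]⟩
  | add e e' ih ih' =>
    obtain ⟨r, hr⟩ := ih
    obtain ⟨r', hr'⟩ := ih'
    exact ⟨r * r', fun a d h => by rw [mul_assoc, add_assoc]; exact hr _ _ (hr' _ _ h)⟩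
  | single v k =>
    refine ⟨S.Xg v ^ k, fun a d h => ?_⟩
    induction k with
    | zero => simpa using h
    | succ k ih =>
      rw [pow_succ', mul_assoc, add_comm k 1, Finsupp.single_add, add_assoc]
      exact S.isLM_Xg_mul v ih

/-- Left multiplication by `r` raises the degree of homogeneous elements by `t`. -/
def RaisesDegree (r : R) (t : ℕ) : Prop :=
  ∀ (a : R) (k : ℕ), (S.Psi a).IsHomogeneous k → (S.Psi (r * a)).IsHomogeneous (t + k)

theorem raisesDegree_one : S.RaisesDegree 1 0 := fun a k h => by rwa [one_mul, zero_add]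

theorem RaisesDegree.mul {S : Setting n N K R} {r r' : R} {t t' : ℕ} (h : S.RaisesDegree r t)
    (h' : S.RaisesDegree r' t') : S.RaisesDegree (r * r') (t + t') := fun a k ha => by
  rw [mul_assoc, add_assoc]; exact h _ _ (h' _ _ ha)

theorem raisesDegree_Xg (v : Vars n) : S.RaisesDegree (S.Xg v) 1 := by
  intro a k h
  obtain ⟨q, hq, hsupp⟩ := S.Psi_Xg_mul v a
  rw [hq]
  refine ((isHomogeneous_monomial _ (Finsupp.degree_single v 1)).mul h).add ?_
  intro e he
  obtain ⟨d, hd, hdeg, -⟩ := hsupp e (mem_support_iff.2 he)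
  have hk : mdeg d = k := by
    by_contra hne
    exact mem_support_iff.1 hd (h.coeff_eq_zero hne)
  rw [hk, mdeg_eq_degree] at hdeg
  rw [Finsupp.degree_eq_weight_one] at hdeg
  exact hdeg

theorem raisesDegree_Xg_pow (v : Vars n) (k : ℕ) : S.RaisesDegree (S.Xg v ^ k) k := by
  induction k with
  | zero => simpa using S.raisesDegree_one
  | succ k ih => rw [pow_succ]; exact ih.mul (S.raisesDegree_Xg v)

theorem raisesDegree_prod_ofFn {m : ℕ} (f : Fin m → R) (t : Fin m → ℕ)
    (h : ∀ i, S.RaisesDegree (f i) (t i)) : S.RaisesDegree (List.ofFn f).prod (∑ i, t i) := by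
  induction m with
  | zero => simpa using S.raisesDegree_one
  | succ m ih =>
    rw [List.ofFn_succ, List.prod_cons, Fin.sum_univ_succ]
    exact (h 0).mul (ih _ _ fun i => h i.succ)

theorem raisesDegree_monR (d : Mon n) : S.RaisesDegree (S.monR d) (mdeg d) := by
  rw [monR_eq, mdeg_eq_sum, Fintype.sum_sum_type]
  exact (S.raisesDegree_Xg_pow _ _).mul
    ((S.raisesDegree_prod_ofFn _ _ fun _ => S.raisesDegree_Xg_pow _ _).mul
      (S.raisesDegree_prod_ofFn _ _ fun _ => S.raisesDegree_Xg_pow _ _))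

end Multiplication

end Setting

namespace Setting

section Syzygies

variable {n N : ℕ} {K : Type*} [Field K] {R : Type*} [Ring R] [Algebra K R]
  (S : Setting n N K R)

theorem nu_add (a b : Fin N → R) : S.nu (a + b) = S.nu a + S.nu b := by
  simp [nu, add_mul, Finset.sum_add_distrib]

theorem nu_smul (k : K) (a : Fin N → R) : S.nu (k • a) = k • S.nu a := by
  simp [nu, Finset.smul_sum]

theorem nu_mul_left (r : R) (a : Fin N → R) : S.nu (fun i => r * a i) = r * S.nu a := by
  simp [nu, Finset.mul_sum, mul_assoc]

theorem IsSyzLM.shift {S : Setting n N K R} {d : Mon n} {i : Fin N} (h : S.IsSyzLM (d, i))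
    (e : Mon n) : S.IsSyzLM (e + d, i) := by
  obtain ⟨a, ha, -, hlast, hlm⟩ := h
  obtain ⟨r, hr⟩ := S.exists_shift e
  have hlm' := hr _ _ hlm
  refine ⟨fun j => r * a j, by rw [nu_mul_left, ha, mul_zero], fun h0 => hlm'.ne_zero ?_,
    fun j hj => ?_, hlm'⟩
  · exact (congrArg S.Psi h0).trans (map_zero _)
  · simp only [hlast j hj, mul_zero]

/-- The module monomials in `LSyz(F)` are exactly the leading monomials of syzygies. -/
theorem inLSyz_iff {m : MMon n N} : S.inLSyz m ↔ S.IsSyzLM m := by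
  classical
  refine ⟨fun h => ?_, fun h => Submodule.subset_span ⟨m, h, rfl⟩⟩
  have key : ∀ v ∈ S.LSyz, ∀ (i : Fin N) (d : Mon n), (v i).coeff d ≠ 0 → S.IsSyzLM (d, i) := by
    intro v hv
    induction hv using Submodule.span_induction with
    | mem v hv =>
      obtain ⟨⟨d', i'⟩, hm, rfl⟩ := hv
      intro i d hne
      by_cases hi : i = i'
      · subst hi
        rw [msingle, Pi.single_eq_same, coeff_monomial] at hne
        split_ifs at hne with hd
        · exact hd ▸ hm
        · exact absurd rfl hne
      · rw [msingle, Pi.single_eq_of_ne hi, coeff_zero] at hne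
        exact absurd rfl hne
    | zero => intro i d hne; simp at hne
    | add v w _ _ hv hw =>
      intro i d hne
      by_cases h0 : (v i).coeff d = 0
      · exact hw i d (by simpa [h0] using hne)
      · exact hv i d h0
    | smul p v _ hv =>
      intro i d hne
      rw [Pi.smul_apply, smul_eq_mul, coeff_mul] at hne
      obtain ⟨⟨d₁, d₂⟩, hd, hne⟩ := Finset.exists_ne_zero_of_sum_ne_zero hne
      rw [← Finset.HasAntidiagonal.mem_antidiagonal.1 hd]
      exact (hv i d₂ (right_ne_zero_of_mul hne)).shift d₁
  obtain ⟨d, i⟩ := m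
  exact key _ h i d (by simp [msingle])

/-- The `i`-th entries, supported in `s`, of the syzygies vanishing beyond the index `i`. -/
def syzSpace (i : Fin N) (s : Set (Mon n)) : Submodule K (Poly n K) where
  carrier := {p | (∀ e ∉ s, p.coeff e = 0) ∧
    ∃ a : Fin N → R, S.nu a = 0 ∧ S.Psi (a i) = p ∧ ∀ j, i < j → a j = 0}
  add_mem' := by
    rintro _ _ ⟨hs, a, ha, rfl, hlast⟩ ⟨hs', b, hb, rfl, hlast'⟩
    refine ⟨fun e he => by rw [coeff_add, hs e he, hs' e he, add_zero], a + b, ?_, ?_, ?_⟩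
    · rw [nu_add, ha, hb, add_zero]
    · rw [Pi.add_apply, map_add]
    · intro j hj
      rw [Pi.add_apply, hlast j hj, hlast' j hj, add_zero]
  zero_mem' := ⟨by simp, 0, by simp [nu], by simp, by simp⟩
  smul_mem' := by
    rintro k _ ⟨hs, a, ha, rfl, hlast⟩
    refine ⟨fun e he => by rw [coeff_smul, hs e he, smul_zero], k • a, ?_, ?_, ?_⟩
    · rw [nu_smul, ha, smul_zero]
    · rw [Pi.smul_apply, map_smul]
    · intro j hj
      rw [Pi.smul_apply, hlast j hj, smul_zero]

theorem finiteDimensional_syzSpace (i : Fin N) {s : Set (Mon n)} (hs : s.Finite) :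
    FiniteDimensional K (S.syzSpace i s) := by
  have := hs.to_subtype
  refine FiniteDimensional.of_injective ((coeffsAt s).domRestrict (S.syzSpace i s)) ?_
  rw [← LinearMap.ker_eq_bot, LinearMap.ker_eq_bot']
  rintro ⟨p, hp⟩ h
  ext e
  by_cases he : e ∈ s
  · exact congrFun h ⟨e, he⟩
  · simpa using hp.1 e he

/-- Every module monomial of `LSyz(F)` is the signature-leading monomial, with coefficient one,
of a syzygy. -/
theorem exists_syzygy_of_inLSyz {m : MMon n N} (hm : S.inLSyz m) :
    ∃ a : Fin N → R, S.nu a = 0 ∧ (S.Psi (a m.2)).coeff m.1 = 1 ∧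
      ∀ x : MMon n N, x.1 ∈ (S.Psi (a x.2)).support → x ≠ m → S.ltSign x m := by
  obtain ⟨d, i⟩ := m
  set s : Set (Mon n) :=
    {e | mdeg e < mdeg d ∨ (mdeg e = mdeg d ∧ wdeg S.D.w e ≤ wdeg S.D.w d)} with hs
  have hfin : s.Finite := (finite_mdeg_le (mdeg d)).subset fun e he => by
    rcases he with h | ⟨h, -⟩
    · exact h.le
    · exact h.le
  have := S.finiteDimensional_syzSpace i hfin
  have hmem : ∀ e ∈ s, S.IsSyzLM (e, i) → e ∈ lmSet S.D (S.syzSpace i s) := by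
    rintro e he ⟨a, ha, -, hlast, hlm⟩
    refine ⟨S.Psi (a i), ⟨fun e' he' => ?_, a, ha, rfl, hlast⟩, hlm⟩
    by_contra hne
    refine he' ?_
    by_cases hee : e' = e
    · exact hee ▸ he
    have he1 := mdeg_lt_or_of_ltTerm _ (hlm.2 e' (mem_support_iff.2 hne) hee)
    dsimp only at he1
    rcases he with h | ⟨h, hw⟩ <;> rcases he1 with h1 | ⟨h1, hw1⟩
    · exact Or.inl (by omega)
    · exact Or.inl (by omega)
    · exact Or.inl (by omega)
    · exact Or.inr ⟨by omega, hw1.trans hw⟩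
  obtain ⟨p, ⟨hps, a, ha, rfl, hlast⟩, hone, hred⟩ :=
    exists_reduced S.D _ (hmem d (Or.inr ⟨rfl, le_rfl⟩) (S.inLSyz_iff.1 hm))
  refine ⟨a, ha, hone, ?_⟩
  rintro ⟨e, j⟩ he hne
  rcases lt_trichotomy j i with hj | rfl | hj
  · exact Or.inl hj
  · have hed : e ≠ d := fun h => hne (by rw [h])
    have hes : e ∈ s := by
      by_contra h
      exact mem_support_iff.1 he (hps e h)
    have hNS : ¬ S.inLSyz (e, j) := fun h => hred e he hed (hmem e hes (S.inLSyz_iff.1 h))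
    refine Or.inr ⟨rfl, ?_⟩
    rcases hes with h | ⟨h, hw⟩
    · exact Or.inl h
    · rcases hw.lt_or_eq with hw | hw
      · exact Or.inr ⟨h, Or.inl hw⟩
      · exact Or.inr ⟨h, Or.inr ⟨hw, Or.inl ⟨hNS, hm⟩⟩⟩
  · simp [hlast j hj] at he

end Syzygies

section SignatureOrder

variable {n N : ℕ} {K : Type*} [Field K] {R : Type*} [Ring R] [Algebra K R]
  (S : Setting n N K R)

theorem ltSign_irrefl (m : MMon n N) : ¬ S.ltSign m m := by
  simp [ltSign, S.D.prec_irrefl]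

theorem ltSign_trans {a b c : MMon n N} (h : S.ltSign a b) (h' : S.ltSign b c) :
    S.ltSign a c := by
  unfold ltSign at *
  rcases h with h | ⟨h1, h | ⟨h2, h | ⟨h3, h⟩⟩⟩ <;>
    rcases h' with h' | ⟨h1', h' | ⟨h2', h' | ⟨h3', h'⟩⟩⟩
  all_goals first
    | exact Or.inl (by omega)
    | exact Or.inr ⟨by omega, Or.inl (by omega)⟩
    | exact Or.inr ⟨by omega, Or.inr ⟨by omega, Or.inl (by linarith)⟩⟩
    | skip
  refine Or.inr ⟨by omega, Or.inr ⟨by omega, Or.inr ⟨by linarith, ?_⟩⟩⟩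
  have := fun h h' => S.D.prec_trans (u := xiPart a.1) (v := xiPart b.1) (t := xiPart c.1) h h'
  tauto

theorem ltSign_trichotomy {a b : MMon n N} (hab : a ≠ b) : S.ltSign a b ∨ S.ltSign b a := by
  unfold ltSign
  rcases lt_trichotomy a.2 b.2 with h | h | h
  · exact Or.inl (Or.inl h)
  · rcases lt_trichotomy (mdeg a.1) (mdeg b.1) with h1 | h1 | h1
    · exact Or.inl (Or.inr ⟨h, Or.inl h1⟩)
    · rcases lt_trichotomy (wdeg S.D.w a.1) (wdeg S.D.w b.1) with h2 | h2 | h2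
      · exact Or.inl (Or.inr ⟨h, Or.inr ⟨h1, Or.inl h2⟩⟩)
      · have h3 := S.D.prec_trichotomy (xiPart a.1) (xiPart b.1)
        have h4 : xiPart a.1 ≠ xiPart b.1 := fun h3 =>
          hab (Prod.ext (eq_of_xiPart_eq h3 h1) h)
        have h5 := h.symm
        have h6 := h1.symm
        have h7 := h2.symm
        tauto
      · exact Or.inr (Or.inr ⟨h.symm, Or.inr ⟨h1.symm, Or.inl h2⟩⟩)
    · exact Or.inr (Or.inr ⟨h.symm, Or.inl h1⟩)
  · exact Or.inr (Or.inl h)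

theorem wellFounded_ltSign : WellFounded S.ltSign := by
  have : IsStrictOrder (MMon n N) S.ltSign :=
    { irrefl := S.ltSign_irrefl, trans := fun _ _ _ => S.ltSign_trans }
  have hwf : WellFounded (Function.onFun (Prod.Lex (Prod.Lex (· < ·) (· < ·)) S.ltSign)
      fun m : MMon n N => ((m.2, mdeg m.1), m)) := by
    refine WellFounded.prod_lex_of_wellFoundedOn_fiber
      (rα := Prod.Lex (α := Fin N) (β := ℕ) (· < ·) (· < ·)) (rβ := S.ltSign)
      (f := fun m : MMon n N => (m.2, mdeg m.1)) (g := id) ?_ ?_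
    · exact (WellFounded.prod_lex wellFounded_lt wellFounded_lt).onFun
    · intro k
      refine Set.Finite.wellFoundedOn
        (((finite_mdeg_le k.2).prod (Set.finite_univ (α := Fin N))).subset ?_)
      rintro m rfl
      exact ⟨le_refl (mdeg m.1), trivial⟩
  refine Subrelation.wf (fun {a b} h => ?_) hwf
  refine Prod.lex_iff.2 ?_
  have h' := h
  rcases h' with h' | ⟨h1, h' | ⟨h2, -⟩⟩
  · exact Or.inl (Prod.lex_iff.2 (Or.inl h'))
  · exact Or.inl (Prod.lex_iff.2 (Or.inr ⟨h1, h'⟩))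
  · exact Or.inr ⟨Prod.ext h1 h2, h⟩

end SignatureOrder

section CleanRepresentatives

variable {n N : ℕ} {K : Type*} [Field K] {R : Type*} [Ring R] [Algebra K R]
  (S : Setting n N K R)

/-- The element of `R^N` with given coefficients. -/
def toVec : (MMon n N →₀ K) →ₗ[K] (Fin N → R) :=
  Finsupp.linearCombination K fun m => Pi.single m.2 (S.monR m.1)

/-- The `K`-linear map `ν` in terms of coefficients. -/
def nuCoeff : (MMon n N →₀ K) →ₗ[K] R :=
  Finsupp.linearCombination K fun m => S.monR m.1 * S.F m.2

theorem nu_toVec (c : MMon n N →₀ K) : S.nu (S.toVec c) = S.nuCoeff c := by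
  induction c using Finsupp.induction_linear with
  | zero => simp [nu]
  | add c c' h h' => rw [map_add, nu_add, h, h', map_add]
  | single m k =>
    rw [toVec, nuCoeff, Finsupp.linearCombination_single, Finsupp.linearCombination_single,
      nu_smul]
    simp [nu, Pi.single_apply]

theorem coeff_toVec (c : MMon n N →₀ K) (d : Mon n) (i : Fin N) :
    (S.Psi (S.toVec c i)).coeff d = c (d, i) := by
  classical
  induction c using Finsupp.induction_linear with
  | zero => simp
  | add c c' h h' => rw [map_add, Pi.add_apply, map_add, coeff_add, h, h', Finsupp.add_apply]
  | single m k =>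
    rw [toVec, Finsupp.linearCombination_single, Pi.smul_apply, map_smul, coeff_smul,
      Finsupp.single_apply, smul_eq_mul]
    by_cases hi : i = m.2
    · subst hi
      rw [Pi.single_eq_same, Psi_monR, coeff_monomial]
      simp [Prod.ext_iff]
    · rw [Pi.single_eq_of_ne hi]
      simp [Prod.ext_iff, Ne.symm hi]

theorem toVec_surjective : Function.Surjective S.toVec := by
  intro g
  refine ⟨∑ i, ∑ d ∈ (S.Psi (g i)).support, Finsupp.single (d, i) ((S.Psi (g i)).coeff d), ?_⟩
  simp only [map_sum, toVec, Finsupp.linearCombination_single]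
  conv_rhs => rw [← Finset.univ_sum_single g]
  refine Finset.sum_congr rfl fun i _ => ?_
  conv_rhs => rw [S.sum_coeff_smul_monR (g i)]
  ext j
  by_cases hj : j = i
  · subst hj; simp
  · simp [Pi.single_eq_of_ne hj]

/-- `m` is the greatest element of the support of `c`. -/
def IsTop (c : MMon n N →₀ K) (m : MMon n N) : Prop :=
  m ∈ c.support ∧ ∀ x ∈ c.support, x ≠ m → S.ltSign x m

theorem exists_isTop {c : MMon n N →₀ K} (hc : c ≠ 0) : ∃ m, S.IsTop c m :=
  exists_greatest_of_finite c.support.finite_toSet (by simpa [Finset.nonempty_iff_ne_empty])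
    S.ltSign_irrefl (fun _ _ _ => S.ltSign_trans) fun _ _ _ _ => S.ltSign_trichotomy

theorem isLMsign_toVec (c : MMon n N →₀ K) (m : MMon n N) :
    S.IsLMsign (S.toVec c) m ↔ S.IsTop c m := by
  simp [IsLMsign, IsTop, coeff_toVec]

/-- The module monomials that are at most `m`. -/
def below (m : MMon n N) : Set (MMon n N) := {x | x = m ∨ S.ltSign x m}

/-- The module monomials outside `LSyz(F)`. -/
def normalSet : Set (MMon n N) := {x | ¬ S.inLSyz x}

theorem below_subset_of_mem {x m : MMon n N} (h : x ∈ S.below m) : S.below x ⊆ S.below m := by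
  rintro y (rfl | hy)
  · exact h
  · rcases h with rfl | h
    · exact Or.inr hy
    · exact Or.inr (S.ltSign_trans hy h)

theorem nuCoeff_single_mem (m : MMon n N) :
    S.nuCoeff (Finsupp.single m 1) ∈
      (Finsupp.supported K K (S.normalSet ∩ S.below m)).map S.nuCoeff := by
  induction m using S.wellFounded_ltSign.induction with
  | _ m ih =>
    by_cases hm : S.inLSyz m
    · obtain ⟨a, ha, hone, hlow⟩ := S.exists_syzygy_of_inLSyz hm
      obtain ⟨c, rfl⟩ := S.toVec_surjective a
      rw [coeff_toVec] at hone
      rw [nu_toVec] at ha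
      set b := Finsupp.single m 1 - c with hb
      have hbm : b m = 0 := by simp [hb, hone]
      have hbs : ∀ x ∈ b.support, S.ltSign x m := by
        intro x hx
        have hxm : x ≠ m := by rintro rfl; exact Finsupp.mem_support_iff.1 hx hbm
        refine hlow x ?_ hxm
        rw [mem_support_iff, coeff_toVec]
        intro h0
        refine Finsupp.mem_support_iff.1 hx ?_
        simp [hb, h0, Finsupp.single_eq_of_ne hxm]
      have hnu : S.nuCoeff (Finsupp.single m 1) = S.nuCoeff b := by rw [hb, map_sub, ha, sub_zero]
      rw [hnu, ← Finsupp.sum_single b, Finsupp.sum, map_sum]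
      refine Submodule.sum_mem _ fun x hx => ?_
      rw [← mul_one (b x), ← smul_eq_mul, ← Finsupp.smul_single, map_smul]
      refine Submodule.smul_mem _ _ (Submodule.map_mono (Finsupp.supported_mono ?_)
        (ih x (hbs x hx)))
      exact Set.inter_subset_inter_right _ (S.below_subset_of_mem (Or.inr (hbs x hx)))
    · exact Submodule.mem_map_of_mem (Finsupp.single_mem_supported K _ ⟨hm, Or.inl rfl⟩)

/-- Every element of `I` has a representative supported outside `LSyz(F)`, and passing to it does
not increase the leading module monomial. -/
theorem exists_normal_of_below {c : MMon n N →₀ K} {m : MMon n N}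
    (hc : c ∈ Finsupp.supported K K (S.below m)) :
    ∃ c' ∈ Finsupp.supported K K (S.normalSet ∩ S.below m), S.nuCoeff c' = S.nuCoeff c := by
  have : S.nuCoeff c ∈ (Finsupp.supported K K (S.normalSet ∩ S.below m)).map S.nuCoeff := by
    rw [← Finsupp.sum_single c, Finsupp.sum, map_sum]
    refine Submodule.sum_mem _ fun x hx => ?_
    rw [← mul_one (c x), ← smul_eq_mul, ← Finsupp.smul_single, map_smul]
    refine Submodule.smul_mem _ _ (Submodule.map_mono (Finsupp.supported_mono ?_)
      (S.nuCoeff_single_mem x))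
    exact Set.inter_subset_inter_right _
      (S.below_subset_of_mem ((Finsupp.mem_supported K c).1 hc hx))
  exact this

theorem IsTop.mem_supported {S : Setting n N K R} {c : MMon n N →₀ K} {m : MMon n N}
    (h : S.IsTop c m) : c ∈ Finsupp.supported K K (S.below m) :=
  (Finsupp.mem_supported K c).2 fun x hx => by
    by_cases hxm : x = m
    · exact Or.inl hxm
    · exact Or.inr (h.2 x hx hxm)

theorem exists_normal (c : MMon n N →₀ K) :
    ∃ c' ∈ Finsupp.supported K K S.normalSet, S.nuCoeff c' = S.nuCoeff c := by
  by_cases hc : c = 0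
  · exact ⟨0, Submodule.zero_mem _, by rw [hc]⟩
  · obtain ⟨m, hm⟩ := S.exists_isTop hc
    obtain ⟨c', hc', h⟩ := S.exists_normal_of_below hm.mem_supported
    exact ⟨c', Finsupp.supported_mono Set.inter_subset_left hc', h⟩

/-- A relation supported outside `LSyz(F)` is trivial. -/
theorem eq_zero_of_normal {c : MMon n N →₀ K} (hc : c ∈ Finsupp.supported K K S.normalSet)
    (h : S.nuCoeff c = 0) : c = 0 := by
  by_contra hne
  obtain ⟨⟨d₀, i⟩, hm, hmax⟩ := S.exists_isTop hne
  have hi : S.toVec c i ≠ 0 := by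
    intro h0
    refine Finsupp.mem_support_iff.1 hm ?_
    rw [← S.coeff_toVec, h0, map_zero, coeff_zero]
  obtain ⟨d, hd⟩ := exists_isLM S.D (p := S.Psi (S.toVec c i)) (by simpa using hi)
  have hsyz : S.IsSyzLM (d, i) := by
    refine ⟨S.toVec c, by rw [nu_toVec, h], hi, fun j hj => ?_, hd⟩
    refine S.Psi.injective (MvPolynomial.ext _ _ fun e => ?_)
    rw [coeff_toVec, map_zero, coeff_zero]
    by_contra hej
    have hlt := hmax (e, j) (Finsupp.mem_support_iff.2 hej)
      fun heq => (ne_of_gt hj) (congrArg Prod.snd heq)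
    rcases hlt with hlt | ⟨hlt, -⟩
    · exact lt_asymm hlt hj
    · exact (ne_of_gt hj) hlt
  have hmem : (d, i) ∈ c.support := by
    rw [Finsupp.mem_support_iff, ← S.coeff_toVec]
    exact mem_support_iff.1 hd.1
  exact (Finsupp.mem_supported K c).1 hc hmem (S.inLSyz_iff.2 hsyz)

theorem eq_of_normal {c c' : MMon n N →₀ K} (hc : c ∈ Finsupp.supported K K S.normalSet)
    (hc' : c' ∈ Finsupp.supported K K S.normalSet) (h : S.nuCoeff c = S.nuCoeff c') : c = c' :=
  sub_eq_zero.1 (S.eq_zero_of_normal (Submodule.sub_mem _ hc hc') (by rw [map_sub, h, sub_self]))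

theorem mem_idl_iff {f : R} : f ∈ S.idl ↔ ∃ c, S.nuCoeff c = f := by
  rw [idl, Submodule.mem_span_range_iff_exists_fun]
  constructor
  · rintro ⟨g, rfl⟩
    obtain ⟨c, rfl⟩ := S.toVec_surjective g
    exact ⟨c, (S.nu_toVec c).symm⟩
  · rintro ⟨c, rfl⟩
    exact ⟨S.toVec c, S.nu_toVec c⟩

theorem mem_idl_iff_normal {f : R} :
    f ∈ S.idl ↔ ∃ c ∈ Finsupp.supported K K S.normalSet, S.nuCoeff c = f := by
  rw [mem_idl_iff]
  constructor
  · rintro ⟨c, rfl⟩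
    exact S.exists_normal c
  · rintro ⟨c, -, h⟩
    exact ⟨c, h⟩

theorem isSig_of_isTop {c : MMon n N →₀ K} (hc : c ∈ Finsupp.supported K K S.normalSet)
    {m : MMon n N} (hm : S.IsTop c m) : S.IsSig (S.nuCoeff c) m := by
  refine ⟨⟨S.toVec c, S.nu_toVec c, (S.isLMsign_toVec c m).2 hm⟩, fun g m' hg hm' hlt => ?_⟩
  obtain ⟨b, rfl⟩ := S.toVec_surjective g
  rw [isLMsign_toVec] at hm'
  rw [nu_toVec] at hg
  obtain ⟨c', hc', h⟩ := S.exists_normal_of_below hm'.mem_supported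
  have heq : c' = c :=
    S.eq_of_normal (Finsupp.supported_mono Set.inter_subset_left hc') hc (h.trans hg)
  subst heq
  rcases ((Finsupp.mem_supported K c').1 hc' hm.1).2 with h1 | h1
  · exact S.ltSign_irrefl m' (h1 ▸ hlt)
  · exact S.ltSign_irrefl m' (S.ltSign_trans hlt h1)

theorem IsSig.unique {S : Setting n N K R} {f : R} {m m' : MMon n N} (h : S.IsSig f m)
    (h' : S.IsSig f m') : m = m' := by
  by_contra hne
  obtain ⟨⟨g, hg, hm⟩, hmin⟩ := h
  obtain ⟨⟨g', hg', hm'⟩, hmin'⟩ := h'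
  rcases S.ltSign_trichotomy hne with hlt | hlt
  · exact hmin' g m hg hm hlt
  · exact hmin g' m' hg' hm' hlt

theorem sig_eq [NeZero N] {c : MMon n N →₀ K} (hc : c ∈ Finsupp.supported K K S.normalSet)
    {m : MMon n N} (hm : S.IsTop c m) : S.sig (S.nuCoeff c) = m := by
  have hex : ∃ m, S.IsSig (S.nuCoeff c) m := ⟨m, S.isSig_of_isTop hc hm⟩
  rw [sig, dif_pos hex]
  exact hex.choose_spec.unique (S.isSig_of_isTop hc hm)

end CleanRepresentatives

end Setting

namespace Setting

section Grading

variable {n N : ℕ} {K : Type*} [Field K] {R : Type*} [Ring R] [Algebra K R]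
  (S : Setting n N K R)

/-- The degree of the module monomial `d e_i` when `e_i` is given the degree of `f_i`. -/
def genDeg (x : MMon n N) : ℕ := mdeg x.1 + (S.F_hom x.2).choose

theorem isHomogeneous_Psi_monR_mul (x : MMon n N) :
    (S.Psi (S.monR x.1 * S.F x.2)).IsHomogeneous (S.genDeg x) :=
  S.raisesDegree_monR x.1 _ _ (S.F_hom x.2).choose_spec

theorem homogeneousComponent_Psi_nuCoeff (k : ℕ) (c : MMon n N →₀ K) :
    homogeneousComponent k (S.Psi (S.nuCoeff c)) =
      S.Psi (S.nuCoeff (c.filter fun x => S.genDeg x = k)) := by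
  induction c using Finsupp.induction_linear with
  | zero => rw [Finsupp.filter_zero, map_zero, map_zero, map_zero]
  | add c c' h h' => rw [map_add, map_add, map_add, h, h', Finsupp.filter_add, map_add, map_add]
  | single x a =>
    have hx : (S.Psi (S.nuCoeff (Finsupp.single x a))).IsHomogeneous (S.genDeg x) := by
      rw [nuCoeff, Finsupp.linearCombination_single, map_smul]
      exact (homogeneousSubmodule (Vars n) K _).smul_mem a (S.isHomogeneous_Psi_monR_mul x)
    rw [homogeneousComponent_of_mem hx]
    by_cases hk : S.genDeg x = k
    · rw [Finsupp.filter_single_of_pos (fun x => S.genDeg x = k) hk, if_pos hk.symm]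
    · rw [Finsupp.filter_single_of_neg (fun x => S.genDeg x = k) hk, if_neg (Ne.symm hk),
        map_zero, map_zero]

/-- The total symbols of the elements `ν(c)` with `c` supported in `A`. -/
def imageSpace (A : Set (MMon n N)) : Submodule K (Poly n K) :=
  (Finsupp.supported K K A).map (S.Psi.toLinearMap ∘ₗ S.nuCoeff)

theorem imageSpace_mono {A B : Set (MMon n N)} (h : A ⊆ B) : S.imageSpace A ≤ S.imageSpace B :=
  Submodule.map_mono (Finsupp.supported_mono h)

theorem mem_lmSet_imageSpace {A : Set (MMon n N)} {m : Mon n} :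
    m ∈ lmSet S.D (S.imageSpace A) ↔
      ∃ c ∈ Finsupp.supported K K A, IsLM S.D (S.Psi (S.nuCoeff c)) m := by
  constructor
  · rintro ⟨_, ⟨c, hc, rfl⟩, h⟩
    exact ⟨c, hc, h⟩
  · rintro ⟨c, hc, h⟩
    exact ⟨_, ⟨c, hc, rfl⟩, h⟩

theorem finite_lmSet_imageSpace {A : Set (MMon n N)} (hfin : A.Finite) (hA : A ⊆ S.normalSet) :
    (lmSet S.D (S.imageSpace A)).Finite ∧ (lmSet S.D (S.imageSpace A)).ncard = A.ncard := by
  have := hfin.to_subtype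
  have hinj : Function.Injective ((S.Psi.toLinearMap ∘ₗ S.nuCoeff).domRestrict
      (Finsupp.supported K K A)) := fun c c' h =>
    Subtype.ext (S.eq_of_normal (Finsupp.supported_mono hA c.2) (Finsupp.supported_mono hA c'.2)
      (S.Psi.injective h))
  let e : (A →₀ K) ≃ₗ[K] S.imageSpace A :=
    (Finsupp.supportedEquivFinsupp A).symm ≪≫ₗ (LinearEquiv.ofInjective _ hinj) ≪≫ₗ
      LinearEquiv.ofEq _ _ (LinearMap.range_domRestrict _ _)
  have : Fintype A := Fintype.ofFinite A
  have : FiniteDimensional K (S.imageSpace A) := e.finiteDimensional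
  obtain ⟨h, h'⟩ := finite_lmSet S.D (S.imageSpace A)
  refine ⟨h, ?_⟩
  rw [← h', ← e.finrank_eq, Module.finrank_finsupp_self, ← Nat.card_eq_fintype_card,
    Nat.card_coe_set_eq]

/-- The normal module monomials `x ≤_sign τ` of degree `k`. -/
def normalBelow (k : ℕ) (τ : MMon n N) : Set (MMon n N) :=
  {x | x ∈ S.normalSet ∧ S.genDeg x = k ∧ x ∈ S.below τ}

theorem normalBelow_subset (k : ℕ) (τ : MMon n N) : S.normalBelow k τ ⊆ S.normalSet :=
  fun _ h => h.1

theorem finite_normalBelow (k : ℕ) (τ : MMon n N) : (S.normalBelow k τ).Finite :=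
  ((finite_mdeg_le k).prod Set.finite_univ).subset fun _ hx =>
    ⟨(Nat.le_add_right _ _).trans hx.2.1.le, Set.mem_univ _⟩

/-- The leading monomials that become available exactly at the signature `σ`. -/
def newLM (σ : MMon n N) : Set (Mon n) :=
  lmSet S.D (S.imageSpace (S.normalBelow (S.genDeg σ) σ)) \
    lmSet S.D (S.imageSpace (S.normalBelow (S.genDeg σ) σ \ {σ}))

theorem exists_newLM_eq_singleton {σ : MMon n N} (hσ : σ ∈ S.normalSet) :
    ∃ m, S.newLM σ = {m} := by
  have hfin := S.finite_normalBelow (S.genDeg σ) σ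
  have hmem : σ ∈ S.normalBelow (S.genDeg σ) σ := ⟨hσ, rfl, Or.inl rfl⟩
  obtain ⟨h₁, h₁'⟩ := S.finite_lmSet_imageSpace hfin (S.normalBelow_subset _ _)
  obtain ⟨h₂, h₂'⟩ := S.finite_lmSet_imageSpace (hfin.sdiff (t := {σ}))
    (Set.sdiff_subset.trans (S.normalBelow_subset _ _))
  rw [← Set.ncard_eq_one, newLM,
    Set.ncard_sdiff (lmSet_mono S.D (S.imageSpace_mono Set.sdiff_subset)) h₂, h₁', h₂',
    Set.ncard_sdiff_singleton_of_mem hmem]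
  have := (Set.ncard_pos hfin).2 ⟨σ, hmem⟩
  omega

theorem normalBelow_subset_diff {k : ℕ} {τ σ : MMon n N} (h : S.ltSign τ σ) :
    S.normalBelow k τ ⊆ S.normalBelow k σ \ {σ} := by
  refine fun x hx => ⟨⟨hx.1, hx.2.1, S.below_subset_of_mem (Or.inr h) hx.2.2⟩, ?_⟩
  rintro rfl
  rcases hx.2.2 with rfl | h'
  · exact S.ltSign_irrefl _ h
  · exact S.ltSign_irrefl _ (S.ltSign_trans h h')

end Grading

section Signatures

variable {n N : ℕ} [NeZero N] {K : Type*} [Field K] {R : Type*} [Ring R] [Algebra K R]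
  (S : Setting n N K R)

theorem LMr_mem_lmSet {f : R} (hf : f ∈ S.idl) (hf0 : f ≠ 0) :
    S.LMr f ∈ lmSet S.D (S.imageSpace (S.normalBelow (mdeg (S.LMr f)) (S.sig f))) := by
  obtain ⟨c, hc, rfl⟩ := S.mem_idl_iff_normal.1 hf
  obtain ⟨τ, hτ⟩ := S.exists_isTop (c := c) (by rintro rfl; exact hf0 (map_zero _))
  have hlm := isLM_homogeneousComponent (isLM_LM S.D (S.Psi.map_ne_zero_iff.2 hf0))
  rw [S.homogeneousComponent_Psi_nuCoeff] at hlm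
  rw [S.sig_eq hc hτ]
  refine S.mem_lmSet_imageSpace.2 ⟨_, (Finsupp.mem_supported _ _).2 fun x hx => ?_, hlm⟩
  rw [Finset.mem_coe, Finsupp.support_filter, Finset.mem_filter] at hx
  exact ⟨(Finsupp.mem_supported K c).1 hc hx.1, hx.2,
    (Finsupp.mem_supported K c).1 hτ.mem_supported hx.1⟩

theorem exists_sig_mem {A : Set (MMon n N)} (hA : A ⊆ S.normalSet) {m : Mon n}
    (hm : m ∈ lmSet S.D (S.imageSpace A)) :
    ∃ f ∈ S.idl, f ≠ 0 ∧ S.LMr f = m ∧ S.sig f ∈ A := by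
  obtain ⟨c, hc, hlm⟩ := S.mem_lmSet_imageSpace.1 hm
  have hf0 : S.nuCoeff c ≠ 0 := S.Psi.map_ne_zero_iff.1 hlm.ne_zero
  obtain ⟨τ, hτ⟩ := S.exists_isTop (c := c) (by rintro rfl; exact hf0 (map_zero _))
  refine ⟨_, S.mem_idl_iff.2 ⟨c, rfl⟩, hf0, hlm.LM_eq, ?_⟩
  rw [S.sig_eq (Finsupp.supported_mono hA hc) hτ]
  exact (Finsupp.mem_supported K c).1 hc hτ.1

theorem isOmega_iff {m : Mon n} {σ : MMon n N} :
    S.IsOmega m σ ↔ σ ∈ S.normalSet ∧ m ∈ S.newLM σ := by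
  constructor
  · rintro ⟨⟨f, hf, hf0, rfl, rfl⟩, hmin⟩
    have hmem := S.LMr_mem_lmSet hf hf0
    obtain ⟨f', hf', hf0', hlm, hsig⟩ := S.exists_sig_mem (S.normalBelow_subset _ _) hmem
    have heq : S.sig f' = S.sig f := hsig.2.2.resolve_right (hmin f' hf' hf0' hlm)
    rw [heq] at hsig
    refine ⟨hsig.1, by rwa [hsig.2.1], fun hmem' => ?_⟩
    obtain ⟨g, hg, hg0, hlm', hsig'⟩ :=
      S.exists_sig_mem (Set.sdiff_subset.trans (S.normalBelow_subset _ _)) hmem'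
    exact hmin g hg hg0 hlm' (hsig'.1.2.2.resolve_left hsig'.2)
  · rintro ⟨hσ, hm, hm'⟩
    obtain ⟨f, hf, hf0, hlm, hsig⟩ := S.exists_sig_mem (S.normalBelow_subset _ _) hm
    have hdeg : mdeg m = S.genDeg σ := by
      obtain ⟨c, hc, hc'⟩ := S.mem_lmSet_imageSpace.1 hm
      have hfil : c.filter (fun x => S.genDeg x = S.genDeg σ) = c :=
        Finsupp.filter_eq_self_iff _ _ |>.2 fun x hx =>
          ((Finsupp.mem_supported K c).1 hc (Finsupp.mem_support_iff.2 hx)).2.1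
      rw [← hfil, ← homogeneousComponent_Psi_nuCoeff] at hc'
      by_contra hne
      refine mem_support_iff.1 hc'.1 ?_
      rw [coeff_homogeneousComponent, if_neg (by rwa [← mdeg_eq_degree])]
    have hlow : ∀ g ∈ S.idl, g ≠ 0 → S.LMr g = m → ¬ S.ltSign (S.sig g) σ := by
      rintro g hg hg0 rfl hlt
      have hmem := S.LMr_mem_lmSet hg hg0
      rw [hdeg] at hmem
      exact hm' (lmSet_mono S.D (S.imageSpace_mono (S.normalBelow_subset_diff hlt)) hmem)
    exact ⟨⟨f, hf, hf0, hlm, hsig.2.2.resolve_right (hlow f hf hf0 hlm)⟩, hlow⟩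

theorem exists_isOmega {f : R} (hf : f ∈ S.idl) (hf0 : f ≠ 0) :
    ∃ σ, S.IsOmega (S.LMr f) σ := by
  obtain ⟨σ, ⟨g, hg, hg0, hlm, rfl⟩, hmin⟩ := S.wellFounded_ltSign.has_min
    {σ | ∃ g ∈ S.idl, g ≠ 0 ∧ S.LMr g = S.LMr f ∧ S.sig g = σ} ⟨_, f, hf, hf0, rfl, rfl⟩
  exact ⟨S.sig g, ⟨g, hg, hg0, hlm, rfl⟩,
    fun g' hg' hg0' hlm' => hmin _ ⟨g', hg', hg0', hlm', rfl⟩⟩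

theorem IsOmega.unique {S : Setting n N K R} {m : Mon n} {σ σ' : MMon n N} (h : S.IsOmega m σ)
    (h' : S.IsOmega m σ') : σ = σ' := by
  by_contra hne
  obtain ⟨⟨f, hf, hf0, hlm, rfl⟩, hmin⟩ := h
  obtain ⟨⟨f', hf', hf0', hlm', rfl⟩, hmin'⟩ := h'
  rcases S.ltSign_trichotomy hne with hlt | hlt
  · exact hmin' f hf hf0 hlm hlt
  · exact hmin f' hf' hf0' hlm' hlt

theorem IsOmega.Omega_eq {S : Setting n N K R} {m : Mon n} {σ : MMon n N} (h : S.IsOmega m σ) :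
    S.Omega m = σ := by
  have hex : ∃ σ, S.IsOmega m σ := ⟨σ, h⟩
  rw [Omega, dif_pos hex]
  exact hex.choose_spec.unique h

theorem isOmega_Omega {f : R} (hf : f ∈ S.idl) (hf0 : f ≠ 0) :
    S.IsOmega (S.LMr f) (S.Omega (S.LMr f)) := by
  obtain ⟨σ, hσ⟩ := S.exists_isOmega hf hf0
  rwa [hσ.Omega_eq]

end Signatures

end Setting

end TropF5

open TropF5 MvPolynomial

variable {n N : ℕ} [NeZero N] {K R : Type*} [Field K] [Ring R] [Algebra K R]

/-- Proposition `bijection`. The map `Ω : LM_h(I \ {0}) → NS(Syz(F))`,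
`m ↦ min {s(f) : f ∈ I \ {0}, LM_h(f) = m}`, is well defined and bijective. -/
theorem stmt8 (S : Setting n N K R) :
    (∀ m ∈ {m : Mon n | ∃ f, f ∈ S.idl ∧ f ≠ 0 ∧ S.LMr f = m}, ∃ σ, S.IsOmega m σ) ∧
    Set.BijOn S.Omega {m : Mon n | ∃ f, f ∈ S.idl ∧ f ≠ 0 ∧ S.LMr f = m}
      {m : MMon n N | ¬ S.inLSyz m} := by
  refine ⟨?_, ?_, ?_, ?_⟩
  · rintro _ ⟨f, hf, hf0, rfl⟩
    exact S.exists_isOmega hf hf0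
  · rintro _ ⟨f, hf, hf0, rfl⟩
    exact (S.isOmega_iff.1 (S.isOmega_Omega hf hf0)).1
  · rintro _ ⟨f, hf, hf0, rfl⟩ _ ⟨g, hg, hg0, rfl⟩ heq
    obtain ⟨hσ, hm⟩ := S.isOmega_iff.1 (S.isOmega_Omega hf hf0)
    have hm' := (S.isOmega_iff.1 (S.isOmega_Omega hg hg0)).2
    obtain ⟨m, hsing⟩ := S.exists_newLM_eq_singleton hσ
    rw [← heq, hsing] at hm'
    rw [hsing] at hm
    exact hm.trans hm'.symm
  · intro σ hσ
    obtain ⟨m, hsing⟩ := S.exists_newLM_eq_singleton hσ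
    have hΩ : S.IsOmega m σ := S.isOmega_iff.2 ⟨hσ, hsing ▸ Set.mem_singleton m⟩
    obtain ⟨f, hf, hf0, hlm, -⟩ := hΩ.1
    exact ⟨m, ⟨f, hf, hf0, hlm⟩, hΩ.Omega_eq⟩

end
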